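/- Let 1<p<∞, let E⊆ℝ^N be a measurable set with 0<|E|<∞, and let W:E→M_d(ℂ) be integrable over E (i.e. ∫_E |W(x)| dx < ∞) with a.e. positive-definite values. Then there exists a positive-definite matrix 𝒲_E∈M_d(ℂ) such that (⨍_E |W(x)^{1/p}e|^p dx)^{1/p} ≤ |𝒲_E e| ≤ √d·(⨍_E |W(x)^{1/p}e|^p dx)^{1/p} for all e∈ℂ^d. -/

import Mathlib

open MeasureTheory Filter
open scoped ENNReal ComplexOrder

noncomputable section

namespace TwoWeightBMO

/-- Euclidean norm of a vector in `ℂ^d`. -/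
def vNorm (d : ℕ) (v : Fin d → ℂ) : ℝ := ‖(WithLp.equiv 2 (Fin d → ℂ)).symm v‖

/-- Operator norm (largest singular value) of a `d × d` complex matrix. -/
def mNorm (d : ℕ) (A : Matrix (Fin d) (Fin d) ℂ) : ℝ :=
  ‖Matrix.toEuclideanCLM (𝕜 := ℂ) (n := Fin d) A‖

/-- Real power of a matrix, via the continuous functional calculus
(for a positive definite matrix this is the usual power `A^t`). -/
def matRpow {d : ℕ} (A : Matrix (Fin d) (Fin d) ℂ) (t : ℝ) : Matrix (Fin d) (Fin d) ℂ :=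
  cfc (fun x : ℝ => x ^ t) A

/-- Hölder conjugate exponent `p' = p/(p-1)`. -/
def pconj (p : ℝ) : ℝ := p / (p - 1)

/-- Entrywise average of a matrix-valued function over a set. -/
def matAvg {X : Type*} [MeasureSpace X] {d : ℕ} (B : X → Matrix (Fin d) (Fin d) ℂ)
    (R : Set X) : Matrix (Fin d) (Fin d) ℂ :=
  Matrix.of fun i j => ⨍ x in R, B x i j

/-- `M` is a reducing operator of `W` over `E` with respect to the exponent `p`. -/
def IsReducing {X : Type*} [MeasureSpace X] {d : ℕ} (p : ℝ)
    (W : X → Matrix (Fin d) (Fin d) ℂ) (E : Set X) (M : Matrix (Fin d) (Fin d) ℂ) : Prop :=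
  M.PosDef ∧ ∀ e : Fin d → ℂ,
    (⨍ x in E, vNorm d ((matRpow (W x) (1 / p)).mulVec e) ^ p) ^ (1 / p)
        ≤ vNorm d (M.mulVec e) ∧
      vNorm d (M.mulVec e)
        ≤ Real.sqrt d * (⨍ x in E, vNorm d ((matRpow (W x) (1 / p)).mulVec e) ^ p) ^ (1 / p)

/-- The `A_p` quantity of a matrix weight `W` over a set `R`:
`⨍_R (⨍_R |W(x)^{1/p} W(y)^{-1/p}|^{p'} dy)^{p/p'} dx`. -/
def apQ {X : Type*} [MeasureSpace X] {d : ℕ} (p : ℝ)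
    (W : X → Matrix (Fin d) (Fin d) ℂ) (R : Set X) : ℝ :=
  ⨍ x in R, (⨍ y in R,
      mNorm d (matRpow (W x) (1 / p) * matRpow (W y) (-(1 / p))) ^ pconj p) ^ (p / pconj p)

/-- Local integrability (`L¹_loc`) of a matrix-valued function. -/
def LocIntMat {X : Type*} [MeasureSpace X] [TopologicalSpace X] {d : ℕ}
    (B : X → Matrix (Fin d) (Fin d) ℂ) : Prop :=
  (∀ i j, AEStronglyMeasurable (fun x => B x i j) volume) ∧
    LocallyIntegrable (fun x => mNorm d (B x)) volume

/-- `W` is a matrix `A_p` weight relative to the family of sets `Fam`, with `A_p`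
characteristic bounded by `C`. -/
def IsApWeight {X : Type*} [MeasureSpace X] [TopologicalSpace X] {d : ℕ} (p C : ℝ)
    (W : X → Matrix (Fin d) (Fin d) ℂ) (Fam : Set (Set X)) : Prop :=
  (∀ᵐ x, (W x).PosDef) ∧ LocIntMat W ∧ ∀ R ∈ Fam, apQ p W R ≤ C

/-- The `A_p` characteristic of `W` relative to the family `Fam`, as a value in `ℝ≥0∞`. -/
def apCharE {X : Type*} [MeasureSpace X] {d : ℕ} (p : ℝ)
    (W : X → Matrix (Fin d) (Fin d) ℂ) (Fam : Set (Set X)) : ℝ≥0∞ :=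
  ⨆ R ∈ Fam, ENNReal.ofReal (apQ p W R)

/-- An axis-parallel cube in `ℝ^n` (product of left-closed right-open intervals of equal
positive length). -/
def IsCube {n : ℕ} (Q : Set (Fin n → ℝ)) : Prop :=
  ∃ (a : Fin n → ℝ) (h : ℝ), 0 < h ∧ Q = Set.univ.pi fun i => Set.Ico (a i) (a i + h)

/-- An axis-parallel rectangle in `ℝ^n × ℝ^m`, i.e. a product of two cubes. -/
def IsRectangle {n m : ℕ} (R : Set ((Fin n → ℝ) × (Fin m → ℝ))) : Prop :=
  ∃ Q₁ Q₂, IsCube Q₁ ∧ IsCube Q₂ ∧ R = Q₁ ×ˢ Q₂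

/-- The two-matrix weighted BMO norm over the family `Fam`, with a given choice `RU` of
reducing operators (of the weight `U`, w.r.t. exponent `p`):
`sup_R (⨍_R |V(x)^{1/p}(B(x) − ⟨B⟩_R) 𝒰_R^{-1}|^p dx)^{1/p}`, valued in `ℝ≥0∞`. -/
def bmoS {X : Type*} [MeasureSpace X] {d : ℕ} (p : ℝ)
    (V B : X → Matrix (Fin d) (Fin d) ℂ) (RU : Set X → Matrix (Fin d) (Fin d) ℂ)
    (Fam : Set (Set X)) : ℝ≥0∞ :=
  ⨆ R ∈ Fam, ENNReal.ofReal
    ((⨍ x in R, mNorm d (matRpow (V x) (1 / p) * (B x - matAvg B R) * (RU R)⁻¹) ^ p) ^ (1 / p))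

/-- The variant norm `sup_R ⨍_R |𝒱_R (B(x) − ⟨B⟩_R) 𝒰_R^{-1}| dx`, valued in `ℝ≥0∞`. -/
def bmoTS {X : Type*} [MeasureSpace X] {d : ℕ}
    (B : X → Matrix (Fin d) (Fin d) ℂ) (RU RV : Set X → Matrix (Fin d) (Fin d) ℂ)
    (Fam : Set (Set X)) : ℝ≥0∞ :=
  ⨆ R ∈ Fam, ENNReal.ofReal (⨍ x in R, mNorm d (RV R * (B x - matAvg B R) * (RU R)⁻¹))

/-- The norm `bmo¹`:
`sup_R (⨍_R (⨍_R |V(x)^{1/p}(B(x)−B(y))U(y)^{-1/p}|^{p'} dy)^{p/p'} dx)^{1/p}`. -/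
def bmo1S {X : Type*} [MeasureSpace X] {d : ℕ} (p : ℝ)
    (U V B : X → Matrix (Fin d) (Fin d) ℂ) (Fam : Set (Set X)) : ℝ≥0∞ :=
  ⨆ R ∈ Fam, ENNReal.ofReal
    ((⨍ x in R, (⨍ y in R,
        mNorm d (matRpow (V x) (1 / p) * (B x - B y) * matRpow (U y) (-(1 / p))) ^ pconj p)
          ^ (p / pconj p)) ^ (1 / p))

/-- The norm `bmo²`:
`sup_R (⨍_R (⨍_R |V(x)^{1/p}(B(x)−B(y))U(y)^{-1/p}|^{p} dx)^{p'/p} dy)^{1/p'}`. -/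
def bmo2S {X : Type*} [MeasureSpace X] {d : ℕ} (p : ℝ)
    (U V B : X → Matrix (Fin d) (Fin d) ℂ) (Fam : Set (Set X)) : ℝ≥0∞ :=
  ⨆ R ∈ Fam, ENNReal.ofReal
    ((⨍ y in R, (⨍ x in R,
        mNorm d (matRpow (V x) (1 / p) * (B x - B y) * matRpow (U y) (-(1 / p))) ^ p)
          ^ (pconj p / p)) ^ (1 / pconj p))

/-- A dyadic grid in `ℝ`, presented by its generations: `D k` is the `k`-th generation,
a partition of `ℝ` into left-closed right-open intervals of length `2^{-k}`, each member of
generation `k` being the union of exactly two members of generation `k+1`. -/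
def IsDyadicGridR (D : ℤ → Set (Set ℝ)) : Prop :=
  ∀ k : ℤ,
    (∀ I ∈ D k, ∃ a : ℝ, I = Set.Ico a (a + 2 ^ (-k))) ∧
    (∀ x : ℝ, ∃! I, I ∈ D k ∧ x ∈ I) ∧
    (∀ I ∈ D k, ∃ I₁ ∈ D (k + 1), ∃ I₂ ∈ D (k + 1), I₁ ≠ I₂ ∧ I = I₁ ∪ I₂)

/-- A dyadic grid in `ℝ^n`: the cubes of generation `k` are the products of generation-`k`
intervals of `n` fixed dyadic grids in `ℝ`. -/
def IsDyadicGridRn {n : ℕ} (G : Set (Set (Fin n → ℝ))) : Prop :=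
  ∃ D : Fin n → ℤ → Set (Set ℝ), (∀ i, IsDyadicGridR (D i)) ∧
    G = {Q | ∃ (k : ℤ) (I : Fin n → Set ℝ), (∀ i, I i ∈ D i k) ∧ Q = Set.univ.pi I}

/-- The family of rectangles generated by two families of cubes. -/
def prodFam {n m : ℕ} (G₁ : Set (Set (Fin n → ℝ))) (G₂ : Set (Set (Fin m → ℝ))) :
    Set (Set ((Fin n → ℝ) × (Fin m → ℝ))) :=
  {R | ∃ Q₁ ∈ G₁, ∃ Q₂ ∈ G₂, R = Q₁ ×ˢ Q₂}

/-- A product dyadic grid `𝒟 = 𝒟¹ × 𝒟²` in `ℝ^n × ℝ^m`. -/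
def IsProductDyadicGrid {n m : ℕ} (G₁ : Set (Set (Fin n → ℝ))) (G₂ : Set (Set (Fin m → ℝ)))
    (G : Set (Set ((Fin n → ℝ) × (Fin m → ℝ)))) : Prop :=
  IsDyadicGridRn G₁ ∧ IsDyadicGridRn G₂ ∧ G = prodFam G₁ G₂

/-- Euclidean norm of a vector in `ℝ^n`. -/
def eN {n : ℕ} (v : Fin n → ℝ) : ℝ := Real.sqrt (∑ i, v i ^ 2)

/-- The (scalar) kernel of the double Riesz transform `R^1_j R^2_k` on `ℝ^n × ℝ^m`. -/
def rieszKernel (n m : ℕ) (j : Fin n) (k : Fin m)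
    (x y : (Fin n → ℝ) × (Fin m → ℝ)) : ℝ :=
  ((x.1 j - y.1 j) / eN (x.1 - y.1) ^ (n + 1)) * ((x.2 k - y.2 k) / eN (x.2 - y.2) ^ (m + 1))

/-- Euclidean pairing `⟨v, w⟩ = ∑ v_i conj(w_i)` on `ℂ^d`. -/
def pair (d : ℕ) (v w : Fin d → ℂ) : ℂ := ∑ i, v i * star (w i)

/-- `(∫ |f|^p)^{1/p}` for a `ℂ^d`-valued function, valued in `ℝ≥0∞`. -/
def eVLp {X : Type*} [MeasureSpace X] {d : ℕ} (p : ℝ) (f : X → Fin d → ℂ) : ℝ≥0∞ :=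
  (∫⁻ x, ENNReal.ofReal (vNorm d (f x) ^ p)) ^ (1 / p)

/-- The `L^p(W)` norm `(∫ |W(x)^{1/p} f(x)|^p dx)^{1/p}`, valued in `ℝ≥0∞`. -/
def eWLp {X : Type*} [MeasureSpace X] {d : ℕ} (p : ℝ)
    (W : X → Matrix (Fin d) (Fin d) ℂ) (f : X → Fin d → ℂ) : ℝ≥0∞ :=
  eVLp p fun x => (matRpow (W x) (1 / p)).mulVec (f x)

/-- The Muckenhoupt dual weight `W' = W^{-p'/p}` of `W` (w.r.t. the exponent `p`). -/
def dualW {X : Type*} {d : ℕ} (p : ℝ) (W : X → Matrix (Fin d) (Fin d) ℂ) :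
    X → Matrix (Fin d) (Fin d) ℂ :=
  fun x => matRpow (W x) (-(pconj p / p))

/-- Fourier transform `ρ̂(t) = ∫ ρ(x) e^{-i⟨t,x⟩} dx` on `ℝ^n × ℝ^m`. -/
def ft {n m : ℕ} (ρ : ((Fin n → ℝ) × (Fin m → ℝ)) → ℂ)
    (t : (Fin n → ℝ) × (Fin m → ℝ)) : ℂ :=
  ∫ x, ρ x * Complex.exp (-Complex.I * (((∑ i, t.1 i * x.1 i) + ∑ i, t.2 i * x.2 i : ℝ) : ℂ))

/-- The supports of `f` and `g` are at positive distance. -/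
def SepSupp {X : Type*} [PseudoMetricSpace X] {E F : Type*} [Zero E] [Zero F]
    (f : X → E) (g : X → F) : Prop :=
  ∃ δ : ℝ, 0 < δ ∧ ∀ x ∈ Function.support f, ∀ y ∈ Function.support g, δ ≤ dist x y

/-- Matrices with Gaussian-rational entries (`M_d(ℚ + iℚ)`). -/
def GaussRat {d : ℕ} (A : Matrix (Fin d) (Fin d) ℂ) : Prop :=
  ∀ i j, ∃ q r : ℚ, A i j = (q : ℂ) + (r : ℂ) * Complex.I

end TwoWeightBMO

namespace TwoWeightBMO

section Helpers

open Matrix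
open scoped MatrixOrder

theorem norm_toEuclideanCLM_sq {d : ℕ} (A : Matrix (Fin d) (Fin d) ℂ)
    (u : EuclideanSpace ℂ (Fin d)) :
    ((‖toEuclideanCLM (𝕜 := ℂ) A u‖ ^ 2 : ℝ) : ℂ) =
      inner ℂ u (toEuclideanCLM (𝕜 := ℂ) (Aᴴ * A) u) := by
  have h : toEuclideanCLM (𝕜 := ℂ) (Aᴴ * A) u =
      ContinuousLinearMap.adjoint (toEuclideanCLM (𝕜 := ℂ) A) (toEuclideanCLM (𝕜 := ℂ) A u) := by
    rw [map_mul, ← star_eq_conjTranspose, map_star]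
    rfl
  rw [h, ContinuousLinearMap.adjoint_inner_right, inner_self_eq_norm_sq_to_K]
  push_cast
  rfl

theorem exists_posDef_norm_eq {d : ℕ} (A : Matrix (Fin d) (Fin d) ℂ) (hA : A.det ≠ 0) :
    ∃ M : Matrix (Fin d) (Fin d) ℂ, M.PosDef ∧
      ∀ u, ‖toEuclideanCLM (𝕜 := ℂ) M u‖ = ‖toEuclideanCLM (𝕜 := ℂ) A u‖ := by
  have hs := posSemidef_conjTranspose_mul_self A
  have hM : (CFC.sqrt (Aᴴ * A)).PosSemidef := nonneg_iff_posSemidef.1 (CFC.sqrt_nonneg _)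
  have hsq : CFC.sqrt (Aᴴ * A) * CFC.sqrt (Aᴴ * A) = Aᴴ * A :=
    CFC.sqrt_mul_sqrt_self _ hs.nonneg
  refine ⟨CFC.sqrt (Aᴴ * A), hM.posDef_iff_det_ne_zero.2 fun h => ?_, fun u => ?_⟩
  · have := congrArg Matrix.det hsq
    rw [det_mul, h, det_mul, det_conjTranspose] at this
    simp [hA] at this
  · have h : ((‖toEuclideanCLM (𝕜 := ℂ) (CFC.sqrt (Aᴴ * A)) u‖ ^ 2 : ℝ) : ℂ) =
        ((‖toEuclideanCLM (𝕜 := ℂ) A u‖ ^ 2 : ℝ) : ℂ) := by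
      rw [norm_toEuclideanCLM_sq, norm_toEuclideanCLM_sq, hM.1.eq, hsq]
    exact (sq_eq_sq₀ (norm_nonneg _) (norm_nonneg _)).1 (Complex.ofReal_injective h)

theorem exists_rankOne_perturbation {d : ℕ} (y : EuclideanSpace ℂ (Fin d)) {ε : ℝ}
    (hε : 0 ≤ ε) (hε1 : ε < 1) :
    ∃ P : Matrix (Fin d) (Fin d) ℂ,
      (∀ w, ‖toEuclideanCLM (𝕜 := ℂ) P w‖ ^ 2 = (1 - ε) * ‖w‖ ^ 2 + ε * ‖inner ℂ y w‖ ^ 2) ∧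
      ‖P.det‖ ^ 2 = (1 - ε) ^ d * (1 + ε / (1 - ε) * ‖y‖ ^ 2) := by
  set v : Fin d → ℂ := y.ofLp with hv
  set Q : Matrix (Fin d) (Fin d) ℂ := (1 - ε) • 1 + ε • vecMulVec v (star v) with hQ
  have hQs : Q.PosSemidef :=
    (PosSemidef.one.smul (sub_nonneg.2 hε1.le)).add ((posSemidef_vecMulVec_self_star v).smul hε)
  obtain ⟨P, hP⟩ := CStarAlgebra.nonneg_iff_eq_star_mul_self.mp hQs.nonneg
  rw [star_eq_conjTranspose] at hP
  have hvv : star v ⬝ᵥ v = ((‖y‖ ^ 2 : ℝ) : ℂ) := by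
    have := inner_self_eq_norm_sq_to_K (𝕜 := ℂ) y
    rw [EuclideanSpace.inner_eq_star_dotProduct, dotProduct_comm] at this
    rw [this]; push_cast; rfl
  refine ⟨P, fun w => ?_, ?_⟩
  · apply Complex.ofReal_injective
    rw [norm_toEuclideanCLM_sq, ← hP]
    have h1 : toEuclideanCLM (𝕜 := ℂ) Q w = ((1 - ε : ℝ) : ℂ) • w + ((ε : ℂ) * inner ℂ y w) • y := by
      apply (WithLp.linearEquiv 2 ℂ (Fin d → ℂ)).injective
      ext i
      simp [hQ, ofLp_toEuclideanCLM, smul_mulVec, vecMulVec_mulVec,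
        EuclideanSpace.inner_eq_star_dotProduct, hv, dotProduct_comm]
      ring
    rw [h1, inner_add_right, inner_smul_right, inner_smul_right, inner_self_eq_norm_sq_to_K,
      mul_assoc, ← inner_conj_symm w y, Complex.mul_conj']
    push_cast
    rfl
  · have h2 : (1 - ε : ℝ) ≠ 0 := by linarith
    have h2c : (1 - ε : ℂ) ≠ 0 := by exact_mod_cast h2
    have hQ' : Q = ((1 - ε : ℝ) : ℂ) • (1 + replicateCol Unit (((ε / (1 - ε) : ℝ) : ℂ) • v) *
        replicateRow Unit (star v)) := by
      rw [← vecMulVec_eq, smul_vecMulVec, smul_add, smul_smul, hQ]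
      congr 1
      push_cast
      rw [mul_div_cancel₀ _ h2c]
      ext i j
      simp
    have h3 : Q.det = (((1 - ε) ^ d * (1 + ε / (1 - ε) * ‖y‖ ^ 2) : ℝ) : ℂ) := by
      rw [hQ', det_smul, det_one_add_replicateCol_mul_replicateRow, dotProduct_smul, hvv]
      simp
    have h4 : Q.det = ((‖P.det‖ ^ 2 : ℝ) : ℂ) := by
      rw [hP, det_mul, det_conjTranspose, mul_comm]
      simpa using Complex.mul_conj' P.det
    exact Complex.ofReal_injective (h4.symm.trans h3)

theorem exists_one_lt_perturbation_det (d : ℕ) {s : ℝ} (hs : (d : ℝ) < s) (hs1 : 1 < s) :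
    ∃ ε : ℝ, 0 ≤ ε ∧ ε < 1 ∧ 1 < (1 - ε) ^ d * (1 + ε / (1 - ε) * s) := by
  have hd : (0 : ℝ) ≤ d := Nat.cast_nonneg d
  set ε : ℝ := (s - d) / (2 * (d + 1) * s) with hε
  have hden : 0 < 2 * ((d : ℝ) + 1) * s := by positivity
  have hmul : ε * (2 * (d + 1) * s) = s - d := div_mul_cancel₀ _ hden.ne'
  have h0 : 0 < ε := div_pos (sub_pos.2 hs) hden
  have h1 : ε < 1 := by
    rw [hε, div_lt_one hden]; nlinarith
  refine ⟨ε, h0.le, h1, ?_⟩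
  have hb : 1 - d * ε ≤ (1 - ε) ^ d := by
    have := one_add_mul_le_pow (a := -ε) (by linarith) d
    calc 1 - d * ε = 1 + d * -ε := by ring
      _ ≤ (1 + -ε) ^ d := this
      _ = _ := by ring_nf
  have h1' : 0 < 1 - ε := by linarith
  have hpos : 0 < 1 + ε / (1 - ε) * s := by positivity
  refine lt_of_lt_of_le ?_ (mul_le_mul_of_nonneg_right hb hpos.le)
  have key : 1 - ε < (1 - d * ε) * (1 - ε + ε * s) := by
    have : d * ε * (s - 1) < s - d := by
      nlinarith [mul_pos h0 (by linarith : 0 < s), mul_nonneg hd h0.le]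
    nlinarith
  have : (1 - d * ε) * (1 + ε / (1 - ε) * s) = (1 - d * ε) * (1 - ε + ε * s) / (1 - ε) := by
    field_simp
  rw [this, lt_div_iff₀ h1']
  linarith

theorem continuous_toEuclideanCLM_apply {d : ℕ} (u : EuclideanSpace ℂ (Fin d)) :
    Continuous fun A : Matrix (Fin d) (Fin d) ℂ => toEuclideanCLM (𝕜 := ℂ) A u :=
  LinearMap.continuous_of_finiteDimensional
    { toFun := fun A : Matrix (Fin d) (Fin d) ℂ => toEuclideanCLM (𝕜 := ℂ) A u
      map_add' := fun A B => by simp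
      map_smul' := fun (a : ℂ) B => by simp }

open scoped Matrix.Norms.L2Operator in
theorem exists_maximal_det {d : ℕ} {F : Type*} [NormedAddCommGroup F] [NormedSpace ℂ F]
    (T : EuclideanSpace ℂ (Fin d) →ₗ[ℂ] F) (hT : Function.Injective T) :
    ∃ A : Matrix (Fin d) (Fin d) ℂ, A.det ≠ 0 ∧ (∀ u, ‖toEuclideanCLM (𝕜 := ℂ) A u‖ ≤ ‖T u‖) ∧
      ∀ B : Matrix (Fin d) (Fin d) ℂ, (∀ u, ‖toEuclideanCLM (𝕜 := ℂ) B u‖ ≤ ‖T u‖) →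
        ‖B.det‖ ≤ ‖A.det‖ := by
  set K : Set (Matrix (Fin d) (Fin d) ℂ) := {A | ∀ u, ‖toEuclideanCLM (𝕜 := ℂ) A u‖ ≤ ‖T u‖} with hK
  obtain ⟨c, hc, hcT⟩ := T.exists_antilipschitzWith (LinearMap.ker_eq_bot.2 hT)
  have hc' : (0 : ℝ) < c := hc
  have hIK : ((c : ℂ)⁻¹) • (1 : Matrix (Fin d) (Fin d) ℂ) ∈ K := fun u => by
    have := hcT.le_mul_dist u 0
    rw [dist_zero_right, map_zero, dist_zero_right] at this
    rw [map_smul, map_one, _root_.smul_apply, norm_smul]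
    simpa [inv_mul_le_iff₀ hc'] using this
  have hbdd : Bornology.IsBounded K := by
    refine isBounded_iff_forall_norm_le.2 ⟨‖LinearMap.toContinuousLinearMap T‖, fun A hA => ?_⟩
    rw [cstar_norm_def]
    exact ContinuousLinearMap.opNorm_le_bound _ (norm_nonneg _) fun u =>
      (hA u).trans ((LinearMap.toContinuousLinearMap T).le_opNorm u)
  have hclosed : IsClosed K := by
    simp only [hK, Set.ofPred_forall]
    refine isClosed_iInter fun u => isClosed_le ?_ continuous_const
    exact (continuous_toEuclideanCLM_apply u).norm
  have : ProperSpace (Matrix (Fin d) (Fin d) ℂ) := FiniteDimensional.proper ℂ _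
  obtain ⟨A, hA, hmax⟩ := (Metric.isCompact_of_isClosed_isBounded hclosed hbdd).exists_isMaxOn
    ⟨_, hIK⟩ (f := fun A => ‖A.det‖) (continuous_id.matrix_det.norm.continuousOn)
  refine ⟨A, fun h => ?_, hA, fun B hB => hmax hB⟩
  have h2 : ‖(((c : ℂ)⁻¹) • (1 : Matrix (Fin d) (Fin d) ℂ)).det‖ ≤ ‖A.det‖ := hmax hIK
  rw [h, det_smul, det_one, norm_zero] at h2
  have : 0 < ‖(c : ℂ)⁻¹ ^ Fintype.card (Fin d) * 1‖ := by
    rw [norm_pos_iff]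
    simp [hc.ne']
  linarith

/-- The Löwner ellipsoid of the unit ball of a norm on `ℂ^d`. -/
theorem exists_loewner_matrix {d : ℕ} {F : Type*} [NormedAddCommGroup F] [NormedSpace ℂ F]
    (T : EuclideanSpace ℂ (Fin d) →ₗ[ℂ] F) (hT : Function.Injective T) :
    ∃ A : Matrix (Fin d) (Fin d) ℂ, A.det ≠ 0 ∧ (∀ u, ‖toEuclideanCLM (𝕜 := ℂ) A u‖ ≤ ‖T u‖) ∧
      ∀ u, ‖T u‖ ≤ Real.sqrt d * ‖toEuclideanCLM (𝕜 := ℂ) A u‖ := by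
  obtain ⟨A, hdet, hA, hmax⟩ := exists_maximal_det T hT
  refine ⟨A, hdet, hA, fun v => ?_⟩
  by_contra! hlt
  have hmulinv : ∀ w, toEuclideanCLM (𝕜 := ℂ) A (toEuclideanCLM (𝕜 := ℂ) A⁻¹ w) = w := fun w => by
    rw [← mul_apply_eq_comp, ← map_mul, mul_nonsing_inv _ hdet.isUnit, map_one]
    rfl
  have hinvmul : ∀ w, toEuclideanCLM (𝕜 := ℂ) A⁻¹ (toEuclideanCLM (𝕜 := ℂ) A w) = w := fun w => by
    rw [← mul_apply_eq_comp, ← map_mul, nonsing_inv_mul _ hdet.isUnit, map_one]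
    rfl
  obtain ⟨g, hg, hgv⟩ := exists_dual_vector'' ℂ (T v)
  set y : EuclideanSpace ℂ (Fin d) := (InnerProductSpace.toDual ℂ _).symm
    (g.comp ((LinearMap.toContinuousLinearMap T).comp (toEuclideanCLM (𝕜 := ℂ) A⁻¹))) with hy
  have hyw : ∀ u, inner ℂ y (toEuclideanCLM (𝕜 := ℂ) A u) = g (T u) := fun u => by
    simp [hy, InnerProductSpace.toDual_symm_apply, hinvmul]
  have hyle : ∀ u, ‖inner ℂ y (toEuclideanCLM (𝕜 := ℂ) A u)‖ ≤ ‖T u‖ := fun u => by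
    rw [hyw]
    exact (g.le_opNorm _).trans (mul_le_of_le_one_left (norm_nonneg _) hg)
  have hTv : ‖T v‖ ≤ ‖y‖ * ‖toEuclideanCLM (𝕜 := ℂ) A v‖ := by
    have h := norm_inner_le_norm (𝕜 := ℂ) y (toEuclideanCLM (𝕜 := ℂ) A v)
    rw [hyw, hgv] at h
    simpa using h
  have hAv : 0 < ‖toEuclideanCLM (𝕜 := ℂ) A v‖ := by
    refine norm_pos_iff.2 fun h => ?_
    rw [h] at hTv hlt
    simp only [norm_zero, mul_zero] at hTv hlt
    linarith
  have hyd : Real.sqrt d < ‖y‖ := lt_of_mul_lt_mul_right (hlt.trans_le hTv) hAv.le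
  have hd : 1 ≤ d := by
    rcases Nat.eq_zero_or_pos d with rfl | h
    · rw [Subsingleton.elim (toEuclideanCLM (𝕜 := ℂ) A v) 0] at hAv
      simp at hAv
    · exact h
  have hd1 : (1 : ℝ) ≤ d := by exact_mod_cast hd
  have hyd2 : (d : ℝ) < ‖y‖ ^ 2 := (Real.sqrt_lt (by positivity) (norm_nonneg _)).1 hyd
  obtain ⟨ε, h0, h1, hε⟩ := exists_one_lt_perturbation_det d hyd2 (hd1.trans_lt hyd2)
  obtain ⟨P, hP, hPdet⟩ := exists_rankOne_perturbation y h0 h1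
  have hPA := hmax (P * A) fun u => by
    rw [map_mul, mul_apply_eq_comp]
    refine (sq_le_sq₀ (norm_nonneg _) (norm_nonneg _)).1 ?_
    rw [hP]
    have e1 : ‖toEuclideanCLM (𝕜 := ℂ) A u‖ ^ 2 ≤ ‖T u‖ ^ 2 := by gcongr; exact hA u
    have e2 : ‖inner ℂ y (toEuclideanCLM (𝕜 := ℂ) A u)‖ ^ 2 ≤ ‖T u‖ ^ 2 := by gcongr; exact hyle u
    nlinarith [mul_le_mul_of_nonneg_left e1 (sub_nonneg.2 h1.le), mul_le_mul_of_nonneg_left e2 h0]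
  rw [det_mul, norm_mul] at hPA
  have hP1 : ‖P.det‖ ≤ 1 := le_of_mul_le_mul_right (by simpa using hPA) (norm_pos_iff.2 hdet)
  rw [← hPdet] at hε
  nlinarith [norm_nonneg P.det]

theorem exists_posDef_comparable {d : ℕ} {F : Type*} [NormedAddCommGroup F] [NormedSpace ℂ F]
    (T : EuclideanSpace ℂ (Fin d) →ₗ[ℂ] F) (hT : Function.Injective T) :
    ∃ M : Matrix (Fin d) (Fin d) ℂ, M.PosDef ∧
      ∀ u, ‖T u‖ ≤ ‖toEuclideanCLM (𝕜 := ℂ) M u‖ ∧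
        ‖toEuclideanCLM (𝕜 := ℂ) M u‖ ≤ Real.sqrt d * ‖T u‖ := by
  obtain ⟨A, hdet, hA, hA'⟩ := exists_loewner_matrix T hT
  have hsd : ((Real.sqrt d : ℂ) • A).det ≠ 0 := by
    rw [det_smul]
    refine mul_ne_zero ?_ hdet
    rcases Nat.eq_zero_or_pos d with rfl | h
    · simp
    · refine pow_ne_zero _ (Complex.ofReal_ne_zero.2 (Real.sqrt_ne_zero'.2 ?_))
      exact_mod_cast h
  obtain ⟨M, hM, hMA⟩ := exists_posDef_norm_eq _ hsd
  refine ⟨M, hM, fun u => ?_⟩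
  have h : ‖toEuclideanCLM (𝕜 := ℂ) M u‖ = Real.sqrt d * ‖toEuclideanCLM (𝕜 := ℂ) A u‖ := by
    rw [hMA, map_smul, _root_.smul_apply, norm_smul, Complex.norm_real,
      Real.norm_of_nonneg (Real.sqrt_nonneg _)]
  rw [h]
  exact ⟨hA' u, mul_le_mul_of_nonneg_left (hA u) (Real.sqrt_nonneg _)⟩

open scoped Matrix.Norms.L2Operator in
theorem mNorm_matRpow_le {d : ℕ} {A : Matrix (Fin d) (Fin d) ℂ} (hA : A.PosSemidef) {t : ℝ}
    (ht : 0 ≤ t) : mNorm d (matRpow A t) ≤ mNorm d A ^ t := by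
  change ‖cfc (fun x : ℝ => x ^ t) A‖ ≤ ‖A‖ ^ t
  refine norm_cfc_le (by positivity) fun x hx => ?_
  have hx0 : 0 ≤ x := spectrum_nonneg_of_nonneg hA.nonneg hx
  have hxA : ‖x‖ ≤ ‖A‖ :=
    (norm_apply_le_norm_cfc (id : ℝ → ℝ) A hx continuousOn_id hA.1).trans
      (congrArg norm (cfc_id ℝ A hA.1)).le
  rw [Real.norm_of_nonneg (Real.rpow_nonneg hx0 _)]
  exact Real.rpow_le_rpow hx0 ((le_abs_self x).trans hxA) ht

theorem det_matRpow_ne_zero {d : ℕ} {A : Matrix (Fin d) (Fin d) ℂ} (hA : A.PosDef) {t : ℝ}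
    (ht : 0 ≤ t) : (matRpow A t).det ≠ 0 := by
  have hu : IsUnit (matRpow A t) := by
    refine (isUnit_cfc_iff (fun x : ℝ => x ^ t) A
      (Real.continuous_rpow_const ht).continuousOn hA.1).2 fun x hx => ?_
    have hx0 : 0 ≤ x := spectrum_nonneg_of_nonneg hA.posSemidef.nonneg hx
    have hx1 : x ≠ 0 := by
      rintro rfl
      exact spectrum.zero_notMem ℝ hA.isUnit hx
    exact (Real.rpow_pos_of_pos (hx0.lt_of_ne' hx1) _).ne'
  exact ((isUnit_iff_isUnit_det _).1 hu).ne_zero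

open scoped Matrix.Norms.L2Operator in
theorem continuous_matRpow_symmetrize {d : ℕ} {t : ℝ} (ht : 0 ≤ t) :
    Continuous fun A : Matrix (Fin d) (Fin d) ℂ => matRpow ((1 / 2 : ℂ) • (A + Aᴴ)) t := by
  unfold matRpow
  refine Continuous.cfc_of_mem_nhdsSet (s := Set.univ) _ Filter.univ_mem (by fun_prop)
    (fun A => ?_) (Real.continuous_rpow_const ht).continuousOn
  rw [← isHermitian_iff_isSelfAdjoint, IsHermitian, conjTranspose_smul, conjTranspose_add,
    conjTranspose_conjTranspose, add_comm]
  simp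

theorem aestronglyMeasurable_matRpow {X : Type*} [MeasurableSpace X] {μ : Measure X} {d : ℕ}
    {W : X → Matrix (Fin d) (Fin d) ℂ} (hW : ∀ i j, AEStronglyMeasurable (fun x => W x i j) μ)
    (hpd : ∀ᵐ x ∂μ, (W x).PosDef) {t : ℝ} (ht : 0 ≤ t) :
    AEStronglyMeasurable (fun x => matRpow (W x) t) μ := by
  have hWm : AEStronglyMeasurable W μ := by
    have h : AEStronglyMeasurable (fun x => ∑ i, ∑ j, W x i j • Matrix.single i j (1 : ℂ)) μ :=
      Finset.aestronglyMeasurable_fun_sum _ fun i _ =>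
        Finset.aestronglyMeasurable_fun_sum _ fun j _ => (hW i j).smul_const _
    refine h.congr (.of_forall fun x => ?_)
    conv_rhs => rw [matrix_eq_sum_single (W x)]
    simp
  refine ((continuous_matRpow_symmetrize ht).comp_aestronglyMeasurable hWm).congr ?_
  filter_upwards [hpd] with x hx
  rw [hx.1.eq, ← two_smul ℂ, smul_smul]
  norm_num

end Helpers

theorem vNorm_mulVec {d : ℕ} (A : Matrix (Fin d) (Fin d) ℂ) (e : Fin d → ℂ) :
    vNorm d (A.mulVec e) = ‖Matrix.toEuclideanCLM (𝕜 := ℂ) A (WithLp.toLp 2 e)‖ := rfl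

theorem memLp_matRpow_mulVec {X : Type*} [MeasurableSpace X] {μ : Measure X} {d : ℕ} {p : ℝ}
    (hp : 0 < p) {W : X → Matrix (Fin d) (Fin d) ℂ}
    (hpd : ∀ᵐ x ∂μ, (W x).PosDef)
    (hW : ∀ i j, AEStronglyMeasurable (fun x => W x i j) μ)
    (hint : Integrable (fun x => mNorm d (W x)) μ) (u : EuclideanSpace ℂ (Fin d)) :
    MemLp (fun x => Matrix.toEuclideanCLM (𝕜 := ℂ) (matRpow (W x) (1 / p)) u)
      (ENNReal.ofReal p) μ := by
  have hp1 : 0 ≤ 1 / p := by positivity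
  have hm := (continuous_toEuclideanCLM_apply u).comp_aestronglyMeasurable
    (aestronglyMeasurable_matRpow hW hpd hp1)
  rw [← integrable_norm_rpow_iff hm (by simpa using hp) ENNReal.ofReal_ne_top,
    ENNReal.toReal_ofReal hp.le]
  refine (hint.mul_const (‖u‖ ^ p)).mono'
    ((hm.norm.aemeasurable.pow_const p).aestronglyMeasurable) ?_
  filter_upwards [hpd] with x hx
  rw [Real.norm_of_nonneg (by positivity)]
  have h0 : 0 ≤ mNorm d (W x) := norm_nonneg _
  calc ‖Matrix.toEuclideanCLM (𝕜 := ℂ) (matRpow (W x) (1 / p)) u‖ ^ p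
      ≤ (mNorm d (W x) ^ (1 / p) * ‖u‖) ^ p := by
        gcongr
        exact (ContinuousLinearMap.le_opNorm _ _).trans
          (mul_le_mul_of_nonneg_right (mNorm_matRpow_le hx.posSemidef hp1) (norm_nonneg _))
    _ = mNorm d (W x) * ‖u‖ ^ p := by
        rw [Real.mul_rpow (by positivity) (norm_nonneg _), ← Real.rpow_mul h0,
          one_div_mul_cancel hp.ne', Real.rpow_one]

theorem exists_posDef_comparable_integral {X : Type*} [MeasurableSpace X] {μ : Measure X}
    [NeZero μ] {d : ℕ} {p : ℝ} (hp : 1 < p) {W : X → Matrix (Fin d) (Fin d) ℂ}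
    (hpd : ∀ᵐ x ∂μ, (W x).PosDef)
    (hW : ∀ i j, AEStronglyMeasurable (fun x => W x i j) μ)
    (hint : Integrable (fun x => mNorm d (W x)) μ) :
    ∃ M : Matrix (Fin d) (Fin d) ℂ, M.PosDef ∧ ∀ e : Fin d → ℂ,
      (∫ x, vNorm d ((matRpow (W x) (1 / p)).mulVec e) ^ p ∂μ) ^ (1 / p)
          ≤ vNorm d (M.mulVec e) ∧
        vNorm d (M.mulVec e)
          ≤ Real.sqrt d * (∫ x, vNorm d ((matRpow (W x) (1 / p)).mulVec e) ^ p ∂μ) ^ (1 / p) := by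
  have hp0 : 0 < p := by linarith
  have : Fact (1 ≤ ENNReal.ofReal p) := ⟨by simpa using hp.le⟩
  have hmem := memLp_matRpow_mulVec hp0 hpd hW hint
  let T : EuclideanSpace ℂ (Fin d) →ₗ[ℂ] Lp (EuclideanSpace ℂ (Fin d)) (ENNReal.ofReal p) μ :=
    { toFun := fun u => (hmem u).toLp _
      map_add' := fun u v => by
        rw [← MemLp.toLp_add]
        exact MemLp.toLp_congr _ _ (.of_forall fun x => by simp)
      map_smul' := fun c u => by
        rw [RingHom.id_apply, ← MemLp.toLp_const_smul]
        exact MemLp.toLp_congr _ _ (.of_forall fun x => by simp) }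
  have hT : Function.Injective T := by
    refine (injective_iff_map_eq_zero T).2 fun u hu => ?_
    have h : (fun x => Matrix.toEuclideanCLM (𝕜 := ℂ) (matRpow (W x) (1 / p)) u) =ᵐ[μ] 0 :=
      (MemLp.toLp_eq_toLp_iff (hmem u) MemLp.zero).1 (hu.trans (MemLp.toLp_zero _).symm)
    obtain ⟨x, hx, hxpd⟩ := (h.and hpd).exists
    have h2 : (matRpow (W x) (1 / p)).mulVec u.ofLp = 0 := congrArg WithLp.ofLp hx
    have h3 := Matrix.eq_zero_of_mulVec_eq_zero (det_matRpow_ne_zero hxpd (by positivity)) h2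
    exact (WithLp.linearEquiv 2 ℂ (Fin d → ℂ)).injective h3
  have hnorm : ∀ e : Fin d → ℂ, ‖T (WithLp.toLp 2 e)‖ =
      (∫ x, vNorm d ((matRpow (W x) (1 / p)).mulVec e) ^ p ∂μ) ^ (1 / p) := fun e => by
    have h : ‖T (WithLp.toLp 2 e)‖ = _ := Lp.norm_toLp _ (hmem (WithLp.toLp 2 e))
    rw [h, (hmem _).eLpNorm_eq_integral_rpow_norm (by simpa using hp0) ENNReal.ofReal_ne_top,
      ENNReal.toReal_ofReal hp0.le, ENNReal.toReal_ofReal (by positivity), one_div]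
    rfl
  obtain ⟨M, hM, hMT⟩ := exists_posDef_comparable T hT
  refine ⟨M, hM, fun e => ?_⟩
  rw [← hnorm, vNorm_mulVec]
  exact hMT _

/-- (Existence of reducing operators.) Let `1 < p < ∞`, let `E ⊆ ℝ^N` be
measurable with `0 < |E| < ∞`, and let `W : E → M_d(ℂ)` be integrable over `E` with a.e.
positive-definite values. Then there exists a positive-definite matrix `𝒲_E` with
`(⨍_E |W(x)^{1/p} e|^p dx)^{1/p} ≤ |𝒲_E e| ≤ √d (⨍_E |W(x)^{1/p} e|^p dx)^{1/p}`
for all `e ∈ ℂ^d`. -/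
theorem reducing_operator_exists (N d : ℕ) (p : ℝ) (hp : 1 < p)
    (E : Set (Fin N → ℝ)) (hEmeas : MeasurableSet E)
    (hEpos : 0 < volume E) (hEfin : volume E < ⊤)
    (W : (Fin N → ℝ) → Matrix (Fin d) (Fin d) ℂ)
    (hWpd : ∀ᵐ x ∂volume.restrict E, (W x).PosDef)
    (hWmeas : ∀ i j, AEStronglyMeasurable (fun x => W x i j) (volume.restrict E))
    (hWint : IntegrableOn (fun x => mNorm d (W x)) E) :
    ∃ M : Matrix (Fin d) (Fin d) ℂ, IsReducing p W E M := by
  rw [← Measure.restrict_apply_univ] at hEpos hEfin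
  have hne : NeZero (volume.restrict E) := ⟨fun h => by simp [h] at hEpos⟩
  have hc1 : (volume.restrict E Set.univ)⁻¹ ≠ ⊤ := ENNReal.inv_ne_top.2 hEpos.ne'
  have hne' : NeZero ((volume.restrict E Set.univ)⁻¹ • volume.restrict E) :=
    ⟨by simpa using ⟨by simpa using hEfin.ne, by simpa using hne.out⟩⟩
  exact exists_posDef_comparable_integral hp (Measure.ae_smul_measure hWpd _)
    (fun i j => (hWmeas i j).smul_measure _) (hWint.smul_measure hc1)

end TwoWeightBMO
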